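/- Let R be a division ring and x,y,z ∈ R with x+z invertible. Define u = y·x·(x+z)⁻¹, v = x+z, w = y·z·(x+z)⁻¹. Then the noncommutative Hirota map (x,y,z) ↦ (u,v,w) satisfies the local Yang–Baxter equation L³_{12}(u)·L³_{13}(v)·L³_{23}(w) = L³_{23}(z)·L³_{13}(y)·L³_{12}(x), where L(x) = [[x,1],[1,0]]. -/

import Mathlib

/-- The noncommutative Hirota map satisfies the local Yang–Baxter equation
for the Lax matrix `L(x) = [[x,1],[1,0]]`. -/
theorem hirota_local_yang_baxter {R : Type*} [DivisionRing R]
    (x y z : R) (hxz : x + z ≠ 0) :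
    (!![y * x * (x + z)⁻¹, 1, 0; 1, 0, 0; 0, 0, 1] *
     !![x + z, 0, 1; 0, 1, 0; 1, 0, 0] *
     !![1, 0, 0; 0, y * z * (x + z)⁻¹, 1; 0, 1, 0] : Matrix (Fin 3) (Fin 3) R)
    = !![1, 0, 0; 0, z, 1; 0, 1, 0] *
      !![y, 0, 1; 0, 1, 0; 1, 0, 0] *
      !![x, 1, 0; 1, 0, 0; 0, 0, 1] := by
  have huv : y * x * (x + z)⁻¹ * (x + z) = y * x := inv_mul_cancel_right₀ hxz _
  have huw : y * z * (x + z)⁻¹ + y * x * (x + z)⁻¹ = y := by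
    rw [← add_mul, ← mul_add, add_comm z x, mul_inv_cancel_right₀ hxz]
  ext i j
  fin_cases i <;> fin_cases j <;>
    simp [Matrix.mul_apply, Fin.sum_univ_three, huv, huw, add_comm]
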